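/- Fix x ∈ S^n and assume q ≤ n. For a tuple g ∈ H_d^ℝ[q], write Φₓ(g) := max{ ‖g(x)‖₂ , σ_q(Δ⁻¹Dₓg) }, where Dₓg is the derivative of g at x restricted to the tangent space TₓS^n = x^⊥. Then: (a) for all g, g̃ ∈ H_d^ℝ[q], |Φₓ(g) − Φₓ(g̃)| ≤ √q·‖g − g̃‖∞; (b) likewise |min_{y∈S^n} Φ_y(g) − min_{y∈S^n} Φ_y(g̃)| ≤ √q·‖g − g̃‖∞; (c) consequently, for every f ∈ H_d^ℝ[q] and every x, Φₓ(f) ≤ √q·‖f‖∞, i.e. the condition number K(f,x) := √q·‖f‖∞/Φₓ(f) satisfies K(f,x) ≥ 1 and K(f) ≥ 1. -/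

import Mathlib

open MvPolynomial

noncomputable def vnorm {m : ℕ} (v : Fin m → ℝ) : ℝ := Real.sqrt (∑ j, v j ^ 2)

noncomputable def polySupNorm {n q : ℕ} (f : Fin q → MvPolynomial (Fin (n + 1)) ℝ) : ℝ :=
  ⨆ x : {x : Fin (n + 1) → ℝ // vnorm x = 1}, ⨆ i : Fin q, |eval x.1 (f i)|

/-- The smallest singular value `σ_q(Δ⁻¹Dₓg)` of the scaled derivative of `g` at `x`
restricted to the tangent space `TₓSⁿ = x^⊥`: it is
`min_{‖u‖=1} ‖(Δ⁻¹Dₓg)* u‖ = min_{‖u‖=1} sup_{w ∈ x^⊥, ‖w‖≤1} |⟨u, Δ⁻¹Dₓg w⟩|`. -/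
noncomputable def sigmaMin {n q : ℕ} (d : Fin q → ℕ) (x : Fin (n + 1) → ℝ)
    (g : Fin q → MvPolynomial (Fin (n + 1)) ℝ) : ℝ :=
  ⨅ u : {u : Fin q → ℝ // vnorm u = 1},
    ⨆ w : {w : Fin (n + 1) → ℝ // vnorm w ≤ 1 ∧ ∑ j, w j * x j = 0},
      |∑ i, u.1 i * ((d i : ℝ)⁻¹ * ∑ j, w.1 j * eval x (pderiv j (g i)))|

/-- `Φₓ(g) = max{‖g(x)‖₂, σ_q(Δ⁻¹Dₓg)}`. -/
noncomputable def Phi {n q : ℕ} (d : Fin q → ℕ) (x : Fin (n + 1) → ℝ)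
    (g : Fin q → MvPolynomial (Fin (n + 1)) ℝ) : ℝ :=
  max (vnorm fun i => eval x (g i)) (sigmaMin d x g)

lemma aux_tri {α : ℝ} (h0 : 0 ≤ α) (h1 : α ≤ Real.pi) :
    HasSum (fun n : ℕ => ((1 - (-1 : ℝ) ^ n) / (n : ℝ) ^ 2) * Real.cos (n * α))
      (Real.pi ^ 2 / 4 - Real.pi / 2 * α) := by
  have hpi := Real.pi_pos
  have key : ∀ x : ℝ, x ∈ Set.Icc (0:ℝ) 1 →
      HasSum (fun n : ℕ => 1 / (n : ℝ) ^ 2 * Real.cos (2 * Real.pi * n * x))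
        (Real.pi ^ 2 * (x ^ 2 - x + 6⁻¹)) := by
    intro x hx
    have h := hasSum_one_div_nat_pow_mul_cos (k := 1) one_ne_zero hx
    have hb := bernoulliFun_two x
    rw [bernoulliFun] at hb
    simp only [mul_one] at h
    rw [hb] at h
    have e : (-1 : ℝ) ^ (1 + 1) * (2 * Real.pi) ^ 2 / 2 / (Nat.factorial 2 : ℕ) *
        (x ^ 2 - x + 6⁻¹) = Real.pi ^ 2 * (x ^ 2 - x + 6⁻¹) := by
      have : ((Nat.factorial 2 : ℕ) : ℝ) = 2 := by norm_num [Nat.factorial]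
      rw [this]; ring
    rw [e] at h
    exact h
  have ha : α / (2 * Real.pi) ≤ 1 / 2 := by
    rw [div_le_iff₀ (by positivity)]; linarith
  have ha0 : 0 ≤ α / (2 * Real.pi) := by positivity
  have A := key (α / (2 * Real.pi)) ⟨ha0, by linarith⟩
  have B := key (α / (2 * Real.pi) + 1 / 2) ⟨by linarith, by linarith⟩
  have C := A.sub B
  have e : ∀ n : ℕ, ((1 - (-1 : ℝ) ^ n) / (n : ℝ) ^ 2) * Real.cos (n * α) =
      1 / (n : ℝ) ^ 2 * Real.cos (2 * Real.pi * n * (α / (2 * Real.pi))) -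
        1 / (n : ℝ) ^ 2 * Real.cos (2 * Real.pi * n * (α / (2 * Real.pi) + 1 / 2)) := by
    intro n
    have e1 : 2 * Real.pi * n * (α / (2 * Real.pi)) = n * α := by field_simp
    have e2 : 2 * Real.pi * n * (α / (2 * Real.pi) + 1 / 2) = n * α + n * Real.pi := by
      field_simp
    rw [e1, e2, Real.cos_add_nat_mul_pi]
    ring
  have e' : Real.pi ^ 2 / 4 - Real.pi / 2 * α =
      Real.pi ^ 2 * ((α / (2 * Real.pi)) ^ 2 - α / (2 * Real.pi) + 6⁻¹) -
      Real.pi ^ 2 * ((α / (2 * Real.pi) + 1 / 2) ^ 2 - (α / (2 * Real.pi) + 1 / 2) + 6⁻¹) := by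
    field_simp
    ring
  rw [e', funext e]
  exact C

lemma aux_bernstein (d : ℕ) (hd : 1 ≤ d) (φ : ℝ → ℝ) (φ' M : ℝ) (a : ℕ → ℂ)
    (hrep : ∀ t : ℝ, (φ t : ℂ) =
      ∑ k ∈ Finset.range (d + 1), a k * Complex.exp (((2 * k - d : ℝ) * t : ℝ) * Complex.I))
    (hder : HasDerivAt φ φ' 0) (hM : ∀ t, |φ t| ≤ M) : |φ'| ≤ d * M := by
  have hpi := Real.pi_pos
  have hd0 : (0:ℝ) < d := by exact_mod_cast hd
  -- derivative value
  have hφ' : (φ' : ℂ) = ∑ k ∈ Finset.range (d + 1), a k * (((2 * k - d : ℝ) : ℂ) * Complex.I) := by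
    have h1 : HasDerivAt (fun t : ℝ => (φ t : ℂ)) (φ' : ℂ) 0 := hder.ofReal_comp
    have h2 : HasDerivAt (fun t : ℝ => (φ t : ℂ))
        (∑ k ∈ Finset.range (d + 1), a k * (((2 * k - d : ℝ) : ℂ) * Complex.I)) 0 := by
      have : (fun t : ℝ => (φ t : ℂ)) = fun t : ℝ => ∑ k ∈ Finset.range (d + 1),
          a k * Complex.exp (((2 * k - d : ℝ) * t : ℝ) * Complex.I) := funext hrep
      rw [this]
      apply HasDerivAt.fun_sum
      intro k _
      apply HasDerivAt.const_mul
      have h3 : HasDerivAt (fun t : ℝ => (2 * k - d : ℝ) * t) (2 * k - d : ℝ) 0 := by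
        simpa using (hasDerivAt_id (0:ℝ)).const_mul (2 * k - d : ℝ)
      have h4 := (h3.ofReal_comp.mul_const Complex.I).cexp
      simpa using h4
    exact h1.unique h2
  set c : ℕ → ℝ := fun n => (1 - (-1 : ℝ) ^ n) / (n : ℝ) ^ 2 with hc
  have hc0 : ∀ n, 0 ≤ c n := by
    intro n
    apply div_nonneg _ (by positivity)
    rcases neg_one_pow_eq_or ℝ n with h | h <;> rw [h] <;> norm_num
  let ψ : ℕ → ℂ := fun n => ∑ k ∈ Finset.range (d + 1),
    a k * (Real.cos (n * (Real.pi - Real.pi * k / d)) : ℂ)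
  have hψ : ∀ n, ‖ψ n‖ ≤ M := by
    intro n
    set s : ℝ := n * Real.pi / (2 * d) with hs
    have e : ψ n = (Complex.exp ((n * Real.pi / 2 : ℝ) * Complex.I) * (φ (-s) : ℂ) +
        Complex.exp ((-(n * Real.pi / 2) : ℝ) * Complex.I) * (φ s : ℂ)) / 2 := by
      rw [hrep, hrep, Finset.mul_sum, Finset.mul_sum, ← Finset.sum_add_distrib, Finset.sum_div]
      apply Finset.sum_congr rfl
      intro k _
      rw [Complex.ofReal_cos, Complex.cos]
      have e1 : ((n * (Real.pi - Real.pi * k / d) : ℝ) : ℂ) * Complex.I =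
          (n * Real.pi / 2 : ℝ) * Complex.I + ((2 * k - d : ℝ) * -s : ℝ) * Complex.I := by
        rw [← add_mul, ← Complex.ofReal_add]
        congr 2
        rw [hs]; field_simp; ring
      have e2 : -((n * (Real.pi - Real.pi * k / d) : ℝ) : ℂ) * Complex.I =
          (-(n * Real.pi / 2) : ℝ) * Complex.I + ((2 * k - d : ℝ) * s : ℝ) * Complex.I := by
        rw [← add_mul, ← Complex.ofReal_add, ← Complex.ofReal_neg]
        congr 2
        rw [hs]; field_simp; ring
      rw [e1, e2, Complex.exp_add, Complex.exp_add]
      ring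
    rw [e, norm_div]
    have := norm_add_le (Complex.exp ((n * Real.pi / 2 : ℝ) * Complex.I) * (φ (-s) : ℂ))
      (Complex.exp ((-(n * Real.pi / 2) : ℝ) * Complex.I) * (φ s : ℂ))
    rw [norm_mul, norm_mul, Complex.norm_exp_ofReal_mul_I, Complex.norm_exp_ofReal_mul_I,
      Complex.norm_real, Complex.norm_real, Real.norm_eq_abs, Real.norm_eq_abs] at this
    have h1 := hM s
    have h2 := hM (-s)
    rw [Complex.norm_ofNat, div_le_iff₀ (by norm_num)]
    linarith
  have hsum : HasSum (fun n => (c n : ℂ) * ψ n)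
      (∑ k ∈ Finset.range (d + 1), a k * ((Real.pi ^ 2 * (2 * k - d) / (4 * d) : ℝ) : ℂ)) := by
    have : (fun n => (c n : ℂ) * ψ n) = fun n => ∑ k ∈ Finset.range (d + 1),
        a k * ((c n * Real.cos (n * (Real.pi - Real.pi * k / d)) : ℝ) : ℂ) := by
      funext n
      simp only [ψ]
      rw [Finset.mul_sum]
      apply Finset.sum_congr rfl
      intro k _
      push_cast
      ring
    rw [this]
    apply hasSum_sum
    intro k hk
    apply HasSum.mul_left
    rw [Complex.hasSum_ofReal]
    have hk' : (k : ℝ) ≤ d := by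
      exact_mod_cast Nat.lt_succ_iff.mp (Finset.mem_range.mp hk)
    have hle : Real.pi * k / d ≤ Real.pi := by
      rw [div_le_iff₀ hd0]; gcongr
    have hge : 0 ≤ Real.pi * k / d := by positivity
    convert aux_tri (α := Real.pi - Real.pi * k / d) (by linarith) (by linarith) using 1
    field_simp
    ring
  have hcs : HasSum c (Real.pi ^ 2 / 4) := by
    simpa [hc] using aux_tri le_rfl hpi.le
  have hbound : ‖∑ k ∈ Finset.range (d + 1),
      a k * ((Real.pi ^ 2 * (2 * k - d) / (4 * d) : ℝ) : ℂ)‖ ≤ Real.pi ^ 2 / 4 * M := by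
    refine hsum.norm_le_of_bounded (hcs.mul_right M) ?_
    intro n
    rw [norm_mul, Complex.norm_real, Real.norm_eq_abs, abs_of_nonneg (hc0 n)]
    exact mul_le_mul_of_nonneg_left (hψ n) (hc0 n)
  have hfin : (φ' : ℂ) = ((4 * d / Real.pi ^ 2 : ℝ) : ℂ) * Complex.I * (∑ k ∈ Finset.range (d + 1),
      a k * ((Real.pi ^ 2 * (2 * k - d) / (4 * d) : ℝ) : ℂ)) := by
    rw [hφ', Finset.mul_sum]
    apply Finset.sum_congr rfl
    intro k _
    have : ((2 * k - d : ℝ) : ℂ) = ((4 * d / Real.pi ^ 2 : ℝ) : ℂ) *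
        ((Real.pi ^ 2 * (2 * k - d) / (4 * d) : ℝ) : ℂ) := by
      rw [← Complex.ofReal_mul]
      congr 1
      field_simp
    rw [this]; ring
  have : |φ'| = ‖(φ' : ℂ)‖ := by rw [Complex.norm_real, Real.norm_eq_abs]
  rw [this, hfin, norm_mul, norm_mul, Complex.norm_I, Complex.norm_real, Real.norm_eq_abs,
    abs_of_nonneg (by positivity), mul_one]
  calc _ ≤ 4 * d / Real.pi ^ 2 * (Real.pi ^ 2 / 4 * M) := by gcongr
    _ = d * M := by field_simp

lemma aux_homog {R : Type*} [CommRing R] {m d : ℕ} {F : MvPolynomial (Fin m) R}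
    (hF : F.IsHomogeneous d) (c : R) (v : Fin m → R) :
    eval (fun j => c * v j) F = c ^ d * eval v F := by
  rw [eval_eq', eval_eq', Finset.mul_sum]
  apply Finset.sum_congr rfl
  intro s hs
  have h : ∑ i, s i = d := by
    have := hF.degree_eq_sum_deg_support hs
    rw [this]
    symm
    apply Finset.sum_subset (Finset.subset_univ _)
    intro i _ hi
    simpa using hi
  simp only [mul_pow, Finset.prod_mul_distrib, Finset.prod_pow_eq_pow_sum, h]
  ring

lemma aux_rep {m d : ℕ} {f : MvPolynomial (Fin m) ℝ} (hf : f.IsHomogeneous d)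
    (x w : Fin m → ℝ) : ∃ a : ℕ → ℂ, ∀ t : ℝ,
    ((eval (fun j => Real.cos t * x j + Real.sin t * w j) f : ℝ) : ℂ) =
      ∑ k ∈ Finset.range (d + 1), a k * Complex.exp (((2 * k - d : ℝ) * t : ℝ) * Complex.I) := by
  let F : MvPolynomial (Fin m) ℂ := map Complex.ofRealHom f
  have hF : F.IsHomogeneous d := hf.map _
  let L : Fin m → Polynomial ℂ := fun j =>
    Polynomial.C ((x j - Complex.I * w j) / 2) * Polynomial.X +
      Polynomial.C ((x j + Complex.I * w j) / 2)
  let Q : Polynomial ℂ := aeval L F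
  have hQ : Q.natDegree < d + 1 := by
    have := aeval_natDegree_le (n := 1) F hF.totalDegree_le L
      (fun i => Polynomial.natDegree_linear_le)
    simp only [Q]; omega
  refine ⟨Q.coeff, fun t => ?_⟩
  set z := Complex.exp (t * Complex.I) with hz
  have hz0 : z ≠ 0 := Complex.exp_ne_zero _
  have hzi : z⁻¹ = Complex.exp (-t * Complex.I) := by rw [hz, ← Complex.exp_neg]; congr 1; ring
  have e1 : ((eval (fun j => Real.cos t * x j + Real.sin t * w j) f : ℝ) : ℂ) =
      eval (fun j => z⁻¹ * Polynomial.eval (z ^ 2) (L j)) F := by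
    have := eval₂_comp_right Complex.ofRealHom (RingHom.id ℝ)
      (fun j => Real.cos t * x j + Real.sin t * w j) f
    change Complex.ofRealHom (eval₂ (RingHom.id ℝ) _ f) = _
    rw [this, eval₂_eq_eval_map]
    simp only [F, MvPolynomial.map_id]
    congr 2
    funext j
    simp only [L, Function.comp, Complex.ofRealHom_eq_coe, Polynomial.eval_add,
      Polynomial.eval_mul, Polynomial.eval_C, Polynomial.eval_X]
    push_cast
    rw [Complex.cos, Complex.sin, ← hzi, ← hz]
    field_simp
    ring
  rw [e1, aux_homog hF]
  have e2 : eval (fun j => Polynomial.eval (z ^ 2) (L j)) F = Polynomial.eval (z ^ 2) Q := by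
    have := MvPolynomial.comp_aeval_apply (R := ℂ) L (Polynomial.aeval (z ^ 2) : _ →ₐ[ℂ] ℂ) F
    simp only [Polynomial.coe_aeval_eq_eval] at this
    simp only [Q]
    rw [this]
    rfl
  rw [e2, Polynomial.eval_eq_sum_range' hQ, Finset.mul_sum]
  apply Finset.sum_congr rfl
  intro k _
  have : Complex.exp (((2 * k - d : ℝ) * t : ℝ) * Complex.I) = z⁻¹ ^ d * (z ^ 2) ^ k := by
    rw [hzi, hz, ← Complex.exp_nat_mul, ← pow_mul, ← Complex.exp_nat_mul, ← Complex.exp_add]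
    congr 1
    push_cast
    ring
  rw [this]; ring

lemma aux_deriv {m : ℕ} (f : MvPolynomial (Fin m) ℝ) (x w : Fin m → ℝ) :
    HasDerivAt (fun t : ℝ => eval (fun j => Real.cos t * x j + Real.sin t * w j) f)
      (∑ j, w j * eval x (pderiv j f)) 0 := by
  induction f using MvPolynomial.induction_on with
  | C r => simpa using hasDerivAt_const (0:ℝ) r
  | add p q hp hq => 
    simp only [map_add, mul_add, Finset.sum_add_distrib]
    exact hp.add hq
  | mul_X p i hp =>
    have h : HasDerivAt (fun t : ℝ => Real.cos t * x i + Real.sin t * w i) (w i) 0 := by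
      have := ((Real.hasDerivAt_cos 0).mul_const (x i)).fun_add ((Real.hasDerivAt_sin 0).mul_const (w i))
      simpa using this
    have := hp.fun_mul h
    simp only [map_mul, eval_X]
    refine this.congr_deriv ?_
    symm
    simp only [Real.cos_zero, Real.sin_zero, one_mul, zero_mul, add_zero, Derivation.leibniz,
      pderiv_X, smul_eq_mul, map_add, map_mul, eval_X, mul_add, Finset.sum_add_distrib,
      Finset.sum_mul]
    rw [add_comm]
    congr 1
    · apply Finset.sum_congr rfl; intros; ring
    · rw [Finset.sum_eq_single i]
      · simp; ring
      · intro b _ hb; simp [Pi.single_apply, hb.symm]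
      · simp

lemma aux_vnorm_sq {m : ℕ} (v : Fin m → ℝ) : vnorm v ^ 2 = ∑ j, v j ^ 2 :=
  Real.sq_sqrt (Finset.sum_nonneg fun _ _ => sq_nonneg _)

lemma aux_vnorm_nonneg {m : ℕ} (v : Fin m → ℝ) : 0 ≤ vnorm v := Real.sqrt_nonneg _

lemma aux_abs_le_vnorm {m : ℕ} (v : Fin m → ℝ) (j : Fin m) : |v j| ≤ vnorm v := by
  apply Real.abs_le_sqrt
  exact Finset.single_le_sum (f := fun j => v j ^ 2) (fun _ _ => sq_nonneg _) (Finset.mem_univ j)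

lemma aux_vnorm_eq {m : ℕ} (v : Fin m → ℝ) : vnorm v = ‖WithLp.toLp 2 v‖ := by
  rw [EuclideanSpace.norm_eq]; simp [vnorm]

lemma aux_vnorm_smul {m : ℕ} (c : ℝ) (v : Fin m → ℝ) : vnorm (fun j => c * v j) = |c| * vnorm v := by
  have : WithLp.toLp 2 (fun j => c * v j) = c • (WithLp.toLp 2 v : EuclideanSpace ℝ (Fin m)) := rfl
  rw [aux_vnorm_eq, aux_vnorm_eq, this, norm_smul, Real.norm_eq_abs]

lemma aux_vnorm_sub {m : ℕ} (v v' : Fin m → ℝ) :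
    vnorm v - vnorm v' ≤ vnorm (fun j => v j - v' j) := by
  have : WithLp.toLp 2 (fun j => v j - v' j) =
    (WithLp.toLp 2 v : EuclideanSpace ℝ (Fin m)) - WithLp.toLp 2 v' := rfl
  rw [aux_vnorm_eq, aux_vnorm_eq, aux_vnorm_eq, this]
  exact norm_sub_norm_le _ _

lemma aux_le_sup {n q : ℕ} (f : Fin q → MvPolynomial (Fin (n + 1)) ℝ)
    (x : Fin (n + 1) → ℝ) (hx : vnorm x = 1) (i : Fin q) :
    |eval x (f i)| ≤ polySupNorm f := by
  have hC : ∀ i, ∃ C, ∀ x ∈ Metric.closedBall (0 : Fin (n + 1) → ℝ) 1, ‖eval x (f i)‖ ≤ C :=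
    fun i => (isCompact_closedBall _ _).exists_bound_of_continuousOn
      (MvPolynomial.continuous_eval (f i)).continuousOn
  choose C hC using hC
  have hball : ∀ x : Fin (n + 1) → ℝ, vnorm x = 1 → x ∈ Metric.closedBall 0 1 := by
    intro x hx
    rw [mem_closedBall_zero_iff, pi_norm_le_iff_of_nonneg zero_le_one]
    intro j
    rw [Real.norm_eq_abs, ← hx]
    exact aux_abs_le_vnorm x j
  haveI : Nonempty (Fin q) := ⟨i⟩
  have hb : BddAbove (Set.range fun x : {x : Fin (n + 1) → ℝ // vnorm x = 1} =>
      ⨆ i : Fin q, |eval x.1 (f i)|) := by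
    refine ⟨∑ i, |C i|, ?_⟩
    rintro _ ⟨y, rfl⟩
    apply ciSup_le
    intro k
    calc _ ≤ C k := hC k y.1 (hball y.1 y.2)
      _ ≤ |C k| := le_abs_self _
      _ ≤ _ := Finset.single_le_sum (f := fun k => |C k|) (fun _ _ => abs_nonneg _)
        (Finset.mem_univ k)
  calc _ ≤ ⨆ i : Fin q, |eval x (f i)| :=
        le_ciSup (f := fun i : Fin q => |eval x (f i)|) (Set.finite_range _).bddAbove i
    _ ≤ _ := le_ciSup hb ⟨x, hx⟩

lemma aux_ball {n q : ℕ} (f : Fin q → MvPolynomial (Fin (n + 1)) ℝ) (d : Fin q → ℕ)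
    (hd : ∀ i, 1 ≤ d i) (hf : ∀ i, (f i).IsHomogeneous (d i))
    (x : Fin (n + 1) → ℝ) (hx : vnorm x = 1)
    (y : Fin (n + 1) → ℝ) (hy : vnorm y ≤ 1) (i : Fin q) :
    |eval y (f i)| ≤ polySupNorm f := by
  have hN : 0 ≤ polySupNorm f := (abs_nonneg _).trans (aux_le_sup f x hx i)
  rcases (aux_vnorm_nonneg y).eq_or_lt with h0 | h0
  · have : y = fun j => 0 * y j := by
      funext j
      have := aux_abs_le_vnorm y j
      rw [← h0] at this
      rw [zero_mul]
      exact abs_nonpos_iff.mp this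
    rw [this, aux_homog (hf i), zero_pow (by have := hd i; omega), zero_mul, abs_zero]
    exact hN
  · have : y = fun j => vnorm y * ((vnorm y)⁻¹ * y j) := by
      funext j; field_simp
    rw [this, aux_homog (hf i), abs_mul, abs_of_nonneg (by positivity)]
    have h1 : vnorm (fun j => (vnorm y)⁻¹ * y j) = 1 := by
      rw [aux_vnorm_smul, abs_of_pos (by positivity)]; field_simp
    have h2 := aux_le_sup f _ h1 i
    calc _ ≤ 1 * polySupNorm f :=
        mul_le_mul (pow_le_one₀ h0.le hy) h2 (abs_nonneg _) zero_le_one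
      _ = _ := one_mul _

lemma aux_kellogg {n q : ℕ} (f : Fin q → MvPolynomial (Fin (n + 1)) ℝ) (d : Fin q → ℕ)
    (hd : ∀ i, 1 ≤ d i) (hf : ∀ i, (f i).IsHomogeneous (d i))
    (x : Fin (n + 1) → ℝ) (hx : vnorm x = 1)
    (w : Fin (n + 1) → ℝ) (hw : vnorm w ≤ 1) (hwx : ∑ j, w j * x j = 0) (i : Fin q) :
    |∑ j, w j * eval x (pderiv j (f i))| ≤ d i * polySupNorm f := by
  obtain ⟨a, ha⟩ := aux_rep (hf i) x w
  refine aux_bernstein (d i) (hd i) _ _ _ a ha (aux_deriv (f i) x w) ?_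
  intro t
  refine aux_ball f d hd hf x hx _ ?_ i
  have h : vnorm (fun j => Real.cos t * x j + Real.sin t * w j) ^ 2 ≤ 1 := by
    have e : vnorm (fun j => Real.cos t * x j + Real.sin t * w j) ^ 2 =
        Real.cos t ^ 2 * vnorm x ^ 2 + Real.sin t ^ 2 * vnorm w ^ 2 +
          2 * Real.cos t * Real.sin t * ∑ j, w j * x j := by
      rw [aux_vnorm_sq, aux_vnorm_sq, aux_vnorm_sq, Finset.mul_sum, Finset.mul_sum,
        Finset.mul_sum, ← Finset.sum_add_distrib, ← Finset.sum_add_distrib]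
      apply Finset.sum_congr rfl
      intro j _
      ring
    rw [e, hwx, hx]
    have h1 : vnorm w ^ 2 ≤ 1 := pow_le_one₀ (aux_vnorm_nonneg w) hw
    have h2 := Real.sin_sq_add_cos_sq t
    nlinarith [sq_nonneg (Real.sin t)]
  exact (sq_le_one_iff₀ (aux_vnorm_nonneg _)).mp h

lemma aux_lin {n q : ℕ} (f : Fin q → MvPolynomial (Fin (n + 1)) ℝ) (d : Fin q → ℕ)
    (hd : ∀ i, 1 ≤ d i) (hf : ∀ i, (f i).IsHomogeneous (d i))
    (x : Fin (n + 1) → ℝ) (hx : vnorm x = 1)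
    (w : Fin (n + 1) → ℝ) (hw : vnorm w ≤ 1) (hwx : ∑ j, w j * x j = 0)
    (u : Fin q → ℝ) (hu : vnorm u = 1) :
    |∑ i, u i * ((d i : ℝ)⁻¹ * ∑ j, w j * eval x (pderiv j (f i)))| ≤
      Real.sqrt q * polySupNorm f := by
  have hq : ∃ i : Fin q, True := by
    by_contra h
    push Not at h
    have : vnorm u = 0 := by
      unfold vnorm
      rw [Finset.sum_eq_zero (fun i _ => (h i).elim), Real.sqrt_zero]
    rw [hu] at this
    exact one_ne_zero this
  obtain ⟨i0, -⟩ := hq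
  have hN : 0 ≤ polySupNorm f := (abs_nonneg _).trans (aux_le_sup f x hx i0)
  have h1 : ∑ i, |u i| ≤ Real.sqrt q := by
    apply Real.le_sqrt_of_sq_le
    have := sq_sum_le_card_mul_sum_sq (s := Finset.univ) (f := fun i => |u i|)
    simp only [sq_abs, ← aux_vnorm_sq, hu, Finset.card_univ, Fintype.card_fin] at this
    simpa using this
  calc _ ≤ ∑ i, |u i * ((d i : ℝ)⁻¹ * ∑ j, w j * eval x (pderiv j (f i)))| :=
        Finset.abs_sum_le_sum_abs _ _
    _ ≤ ∑ i, |u i| * polySupNorm f := by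
        apply Finset.sum_le_sum
        intro i _
        rw [abs_mul]
        apply mul_le_mul_of_nonneg_left _ (abs_nonneg _)
        have hdi : (0:ℝ) < d i := by exact_mod_cast hd i
        rw [abs_mul, abs_of_pos (inv_pos.mpr hdi), inv_mul_le_iff₀ hdi]
        exact aux_kellogg f d hd hf x hx w hw hwx i
    _ = (∑ i, |u i|) * polySupNorm f := by rw [Finset.sum_mul]
    _ ≤ _ := mul_le_mul_of_nonneg_right h1 hN

lemma aux_sigma {n q : ℕ} (hq : 1 ≤ q) (g g' : Fin q → MvPolynomial (Fin (n + 1)) ℝ)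
    (d : Fin q → ℕ)
    (hd : ∀ i, 1 ≤ d i) (hg : ∀ i, (g i).IsHomogeneous (d i))
    (hg' : ∀ i, (g' i).IsHomogeneous (d i))
    (x : Fin (n + 1) → ℝ) (hx : vnorm x = 1) :
    sigmaMin d x g ≤ sigmaMin d x g' + Real.sqrt q * polySupNorm (fun i => g i - g' i) := by
  have hh : ∀ i, (g i - g' i).IsHomogeneous (d i) := fun i => (hg i).sub (hg' i)
  haveI : Nonempty {u : Fin q → ℝ // vnorm u = 1} := by
    refine ⟨⟨Pi.single ⟨0, hq⟩ 1, ?_⟩⟩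
    unfold vnorm
    rw [Finset.sum_eq_single ⟨0, hq⟩]
    · simp
    · intro b _ hb; simp [hb]
    · simp
  haveI : Nonempty {w : Fin (n + 1) → ℝ // vnorm w ≤ 1 ∧ ∑ j, w j * x j = 0} :=
    ⟨⟨0, by simp [vnorm], by simp⟩⟩
  rw [← sub_le_iff_le_add]
  apply le_ciInf
  intro u
  rw [sub_le_iff_le_add]
  refine (ciInf_le (f := fun u : {u : Fin q → ℝ // vnorm u = 1} =>
    ⨆ w : {w : Fin (n + 1) → ℝ // vnorm w ≤ 1 ∧ ∑ j, w j * x j = 0},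
      |∑ i, u.1 i * ((d i : ℝ)⁻¹ * ∑ j, w.1 j * eval x (pderiv j (g i)))|)
    ⟨0, ?_⟩ u).trans ?_
  · rintro _ ⟨v, rfl⟩
    exact Real.iSup_nonneg fun _ => abs_nonneg _
  apply ciSup_le
  intro w
  have h1 := aux_lin _ d hd hh x hx w.1 w.2.1 w.2.2 u.1 u.2
  have h2 : |∑ i, u.1 i * ((d i : ℝ)⁻¹ * ∑ j, w.1 j * eval x (pderiv j (g' i)))| ≤
      ⨆ w : {w : Fin (n + 1) → ℝ // vnorm w ≤ 1 ∧ ∑ j, w j * x j = 0},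
      |∑ i, u.1 i * ((d i : ℝ)⁻¹ * ∑ j, w.1 j * eval x (pderiv j (g' i)))| := by
    refine le_ciSup (f := fun w : {w : Fin (n + 1) → ℝ // vnorm w ≤ 1 ∧ ∑ j, w j * x j = 0} =>
      |∑ i, u.1 i * ((d i : ℝ)⁻¹ * ∑ j, w.1 j * eval x (pderiv j (g' i)))|)
      ⟨Real.sqrt q * polySupNorm g', ?_⟩ w
    rintro _ ⟨v, rfl⟩
    exact aux_lin _ d hd hg' x hx v.1 v.2.1 v.2.2 u.1 u.2
  have e : ∑ i, u.1 i * ((d i : ℝ)⁻¹ * ∑ j, w.1 j * eval x (pderiv j (g i))) =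
      ∑ i, u.1 i * ((d i : ℝ)⁻¹ * ∑ j, w.1 j * eval x (pderiv j (g' i))) +
      ∑ i, u.1 i * ((d i : ℝ)⁻¹ * ∑ j, w.1 j * eval x (pderiv j (g i - g' i))) := by
    rw [← Finset.sum_add_distrib]
    apply Finset.sum_congr rfl
    intro i _
    rw [← mul_add, ← mul_add, ← Finset.sum_add_distrib]
    congr 2
    apply Finset.sum_congr rfl
    intro j _
    rw [map_sub, map_sub]; ring
  rw [e]
  exact (abs_add_le _ _).trans (add_le_add h2 h1)

lemma aux_phi {n q : ℕ} (hq : 1 ≤ q) (g g' : Fin q → MvPolynomial (Fin (n + 1)) ℝ)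
    (d : Fin q → ℕ)
    (hd : ∀ i, 1 ≤ d i) (hg : ∀ i, (g i).IsHomogeneous (d i))
    (hg' : ∀ i, (g' i).IsHomogeneous (d i))
    (x : Fin (n + 1) → ℝ) (hx : vnorm x = 1) :
    Phi d x g ≤ Phi d x g' + Real.sqrt q * polySupNorm (fun i => g i - g' i) := by
  have hN : 0 ≤ polySupNorm (fun i => g i - g' i) :=
    (abs_nonneg _).trans (aux_le_sup _ x hx ⟨0, hq⟩)
  apply max_le
  · have h1 := aux_vnorm_sub (fun i => eval x (g i)) (fun i => eval x (g' i))
    have h2 : vnorm (fun i => eval x (g i) - eval x (g' i)) ≤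
        Real.sqrt q * polySupNorm (fun i => g i - g' i) := by
      unfold vnorm
      rw [← Real.sqrt_sq hN, ← Real.sqrt_mul (Nat.cast_nonneg q)]
      apply Real.sqrt_le_sqrt
      calc _ ≤ ∑ _i : Fin q, polySupNorm (fun i => g i - g' i) ^ 2 := by
            apply Finset.sum_le_sum
            intro i _
            have := aux_le_sup (fun i => g i - g' i) x hx i
            rw [map_sub] at this
            rw [← sq_abs]
            gcongr
        _ = _ := by simp
    have h3 : vnorm (fun i => eval x (g' i)) ≤ Phi d x g' := le_max_left _ _
    linarith
  · have h1 := aux_sigma hq g g' d hd hg hg' x hx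
    have h3 : sigmaMin d x g' ≤ Phi d x g' := le_max_right _ _
    linarith

lemma aux_min {n q : ℕ} (hq : 1 ≤ q) (g g' : Fin q → MvPolynomial (Fin (n + 1)) ℝ)
    (d : Fin q → ℕ)
    (hd : ∀ i, 1 ≤ d i) (hg : ∀ i, (g i).IsHomogeneous (d i))
    (hg' : ∀ i, (g' i).IsHomogeneous (d i))
    (x : Fin (n + 1) → ℝ) (hx : vnorm x = 1) :
    (⨅ y : {y : Fin (n + 1) → ℝ // vnorm y = 1}, Phi d y.1 g) ≤
      (⨅ y : {y : Fin (n + 1) → ℝ // vnorm y = 1}, Phi d y.1 g') +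
        Real.sqrt q * polySupNorm (fun i => g i - g' i) := by
  haveI : Nonempty {y : Fin (n + 1) → ℝ // vnorm y = 1} := ⟨⟨x, hx⟩⟩
  rw [← sub_le_iff_le_add]
  apply le_ciInf
  intro y
  rw [sub_le_iff_le_add]
  refine (ciInf_le (f := fun y : {y : Fin (n + 1) → ℝ // vnorm y = 1} => Phi d y.1 g)
    ⟨0, ?_⟩ y).trans (aux_phi hq g g' d hd hg hg' y.1 y.2)
  rintro _ ⟨v, rfl⟩
  exact (aux_vnorm_nonneg _).trans (le_max_left _ _)

lemma aux_symm {n q : ℕ} (g g' : Fin q → MvPolynomial (Fin (n + 1)) ℝ) :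
    polySupNorm (fun i => g i - g' i) = polySupNorm (fun i => g' i - g i) := by
  unfold polySupNorm
  simp only [map_sub, abs_sub_comm]

/-- Theorem 3.2, 1st Lipschitz property: (a) `g ↦ Φₓ(g)` and (b) `g ↦ min_y Φ_y(g)` are
`√q`-Lipschitz with respect to the real `L∞`-norm, and (c) consequently
`Φₓ(f) ≤ √q ‖f‖∞`, i.e. `K(f,x) ≥ 1` and `K(f) ≥ 1`. -/
theorem first_lipschitz_property (n q : ℕ) (hn : 1 ≤ n) (hq : 1 ≤ q) (hqn : q ≤ n)
    (d : Fin q → ℕ) (hd : ∀ i, 1 ≤ d i)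
    (x : Fin (n + 1) → ℝ) (hx : vnorm x = 1) :
    (∀ g g' : Fin q → MvPolynomial (Fin (n + 1)) ℝ,
      (∀ i, (g i).IsHomogeneous (d i)) → (∀ i, (g' i).IsHomogeneous (d i)) →
      |Phi d x g - Phi d x g'| ≤ Real.sqrt q * polySupNorm (fun i => g i - g' i)) ∧
    (∀ g g' : Fin q → MvPolynomial (Fin (n + 1)) ℝ,
      (∀ i, (g i).IsHomogeneous (d i)) → (∀ i, (g' i).IsHomogeneous (d i)) →
      |(⨅ y : {y : Fin (n + 1) → ℝ // vnorm y = 1}, Phi d y.1 g) -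
        (⨅ y : {y : Fin (n + 1) → ℝ // vnorm y = 1}, Phi d y.1 g')| ≤
        Real.sqrt q * polySupNorm (fun i => g i - g' i)) ∧
    (∀ f : Fin q → MvPolynomial (Fin (n + 1)) ℝ,
      (∀ i, (f i).IsHomogeneous (d i)) → Phi d x f ≤ Real.sqrt q * polySupNorm f) := by
  refine ⟨fun g g' hg hg' => ?_, fun g g' hg hg' => ?_, fun f hf => ?_⟩
  · rw [abs_sub_le_iff]
    have h1 := aux_phi hq g g' d hd hg hg' x hx
    have h2 := aux_phi hq g' g d hd hg' hg x hx
    rw [aux_symm g' g] at h2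
    constructor <;> linarith
  · rw [abs_sub_le_iff]
    have h1 := aux_min hq g g' d hd hg hg' x hx
    have h2 := aux_min hq g' g d hd hg' hg x hx
    rw [aux_symm g' g] at h2
    constructor <;> linarith
  · have h1 := aux_phi hq f (fun _ => 0) d hd hf (fun i => isHomogeneous_zero _ _ _) x hx
    have h0 : Phi d x (fun _ : Fin q => (0 : MvPolynomial (Fin (n + 1)) ℝ)) = 0 := by
      simp [Phi, sigmaMin, vnorm]
    rw [h0, zero_add] at h1
    simpa using h1
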